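/- (Path-Covering Lemma) For every ε′ ∈ (0,1) there exist γ > 0 and n₀ such that the following holds for all n ≥ n₀ and all k ≤ γn. Let D be a digraph on n vertices with δ⁰(D) ≥ n/2 + k which does not satisfy the extremal condition EC with parameter ε′, and let U ⊆ V(D) with |U| ≤ γn. Then D − U contains a Hamiltonian cycle; in particular, D − U contains a Hamiltonian directed path. -/

import Mathlib

open scoped Classical

/-- The out-degree of a vertex `v` in the digraph with arc relation `A`. -/
noncomputable def outDeg {V : Type*} (A : V → V → Prop) (v : V) : ℕ :=
  {u | A v u}.ncard

/-- The in-degree of a vertex `v` in the digraph with arc relation `A`. -/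
noncomputable def inDeg {V : Type*} (A : V → V → Prop) (v : V) : ℕ :=
  {u | A u v}.ncard

/-- The number of arcs directed from `S` to `T`. -/
noncomputable def arcsCount {V : Type*} (A : V → V → Prop) (S T : Set V) : ℕ :=
  {p : V × V | p.1 ∈ S ∧ p.2 ∈ T ∧ A p.1 p.2}.ncard

/-- The extremal condition **EC** with parameter `ε'`. -/
def SatisfiesEC {V : Type*} [Fintype V] (A : V → V → Prop) (ε' : ℝ) : Prop :=
  ∃ U₁ U₂ : Set V,
    (1/2 - ε') * Fintype.card V ≤ (U₁.ncard : ℝ) ∧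
    (1/2 - ε') * Fintype.card V ≤ (U₂.ncard : ℝ) ∧
    (arcsCount A U₁ U₂ : ℝ) ≤ (ε' * Fintype.card V)^2


def IsPath {V : Type*} (A : V → V → Prop) (s t : V) (p : List V) : Prop :=
  p.IsChain A ∧ p.head? = some s ∧ p.getLast? = some t

def IsCyc {V : Type*} (A : V → V → Prop) (c : List V) : Prop :=
  c.IsChain A ∧ ∀ x ∈ c.getLast?, ∀ y ∈ c.head?, A x y

theorem IsCyc.append {V : Type*} {A : V → V → Prop} {c d : List V}
    (hc : c.IsChain A) (hd : d.IsChain A) (hcn : c ≠ []) (hdn : d ≠ [])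
    (h1 : ∀ x ∈ c.getLast?, ∀ y ∈ d.head?, A x y)
    (h2 : ∀ x ∈ d.getLast?, ∀ y ∈ c.head?, A x y) : IsCyc A (c ++ d) := by
  refine ⟨List.isChain_append.2 ⟨hc, hd, h1⟩, ?_⟩
  intro x hx y hy
  apply h2
  · rwa [List.getLast?_append_of_ne_nil _ hdn] at hx
  · rwa [List.head?_append_of_ne_nil _ hcn] at hy

theorem IsCyc.rot {V : Type*} {A : V → V → Prop} {c d : List V}
    (h : IsCyc A (c ++ d)) : IsCyc A (d ++ c) := by
  by_cases hc : c = []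
  · subst hc; simpa using h
  by_cases hd : d = []
  · subst hd; simpa using h
  obtain ⟨h1, h2⟩ := h
  rw [List.isChain_append] at h1
  rw [List.getLast?_append_of_ne_nil _ hd, List.head?_append_of_ne_nil _ hc] at h2
  exact IsCyc.append h1.2.1 h1.1 hd hc h2 h1.2.2

theorem IsPath.append {V : Type*} {A : V → V → Prop} {s t s' t' : V} {p q : List V}
    (hp : IsPath A s t p) (hq : IsPath A s' t' q) (h : A t s') : IsPath A s t' (p ++ q) := by
  obtain ⟨a, b, c⟩ := hp
  obtain ⟨a', b', c'⟩ := hq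
  refine ⟨List.isChain_append.2 ⟨a, a', ?_⟩, ?_, ?_⟩
  · rw [c, b']; simpa using h
  · simp [List.head?_append, b]
  · simp [List.getLast?_append, c']

theorem chain_iter {W : Type*} (f : W → W) (l : List W) : ∀ (a b : W),
    (a :: l).IsChain (fun x y => f x = y) → (a :: l).getLast? = some b → f^[l.length] a = b := by
  induction l with
  | nil => intro a b _ h; simpa using h
  | cons c l ih =>
    intro a b h1 h2
    rw [List.isChain_cons_cons] at h1
    have := ih c b h1.2 (by simpa using h2)
    rw [List.length_cons, Function.iterate_succ_apply, h1.1, this]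

/-- Rotate a cycle list so that a given element comes last. -/
theorem exists_rot {W : Type*} {c : List W} {z : W} (hz : z ∈ c) :
    ∃ l, (l ++ [z]).Perm c ∧ ∀ R : W → W → Prop, IsCyc R c → IsCyc R (l ++ [z]) := by
  obtain ⟨s, t, rfl⟩ := List.append_of_mem hz
  refine ⟨t ++ s, ?_, ?_⟩
  · rw [List.append_assoc]
    refine (List.perm_append_comm).trans ?_
    simp
  · intro R h
    have := IsCyc.rot (c := s ++ [z]) (d := t) (by simpa using h)
    simpa using this

/-- On a cycle, any element reaches the last element of the list in few steps. -/
theorem cyc_reach {W : Type*} {f : W → W} {c : List W} {x y : W}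
    (hc : IsCyc (fun a b => f a = b) c) (hx : c.getLast? = some x) (hy : y ∈ c) :
    ∃ j < c.length, f^[j] y = x := by
  obtain ⟨s, t, rfl⟩ := List.append_of_mem hy
  refine ⟨t.length, by simp; omega, ?_⟩
  apply chain_iter
  · exact (List.isChain_append.1 hc.1).2.1
  · rwa [List.getLast?_append_of_ne_nil _ (by simp)] at hx

def Cover {W : Type*} (A : W → W → Prop) (C : List (List W)) : Prop :=
  C.flatten.Nodup ∧ (∀ v, v ∈ C.flatten) ∧ ∀ c ∈ C, c ≠ [] ∧ IsCyc A c

theorem uniq_of_nodup {W : Type*} {C : List (List W)} (h : C.flatten.Nodup) {c d : List W} {v : W}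
    (hc : c ∈ C) (hd : d ∈ C) (hvc : v ∈ c) (hvd : v ∈ d) : c = d := by
  by_contra hne
  have hd' : d ∈ C.erase c := (List.mem_erase_of_ne (Ne.symm hne)).2 hd
  have := (List.perm_cons_erase hc).flatten.nodup_iff.1 h
  rw [List.flatten_cons, List.nodup_append] at this
  exact this.2.2 v hvc v (List.mem_flatten.2 ⟨d, hd', hvd⟩) rfl

theorem exists_perm {W : Type*} [Fintype W] {C : List (List W)}
    (h : C.flatten.Nodup) (hall : ∀ v, v ∈ C.flatten) :
    ∃ σ : Equiv.Perm W, ∀ c ∈ C, IsCyc (fun a b => σ a = b) c := by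
  have h1 : ∀ v, ∃ c ∈ C, v ∈ c := fun v => List.mem_flatten.1 (hall v)
  choose c hc hvc using h1
  have hnd : ∀ d ∈ C, d.Nodup := (List.nodup_flatten.1 h).1
  have hinj : Function.Injective (fun v => (c v).next v (hvc v)) := by
    intro v w hvw
    simp only at hvw
    have e : c v = c w := by
      refine uniq_of_nodup h (hc v) (hc w) (List.next_mem (c v) v (hvc v)) ?_
      rw [hvw]; exact List.next_mem _ _ _
    have key : ∀ (d e : List W) (hd : d.Nodup) (he : d = e) (hv : v ∈ d) (hw : w ∈ e),
        d.next v hv = e.next w hw → v = w := by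
      intro d e hd he hv hw heq
      subst he
      have := List.prev_next d hd v hv
      rw [← this]
      have h2 := List.prev_next d hd w hw
      conv_rhs => rw [← h2]
      congr 1
    exact key _ _ (hnd _ (hc v)) e _ _ hvw
  refine ⟨Equiv.ofBijective _ (Finite.injective_iff_bijective.1 hinj), ?_⟩
  intro d hd
  have hnext : ∀ v (hv : v ∈ d), (c v).next v (hvc v) = d.next v hv := by
    intro v hv
    have := uniq_of_nodup h (hc v) hd (hvc v) hv
    congr 1
  constructor
  · rw [List.isChain_iff_getElem]
    intro i hi
    simp only [Equiv.ofBijective_apply]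
    rw [hnext _ (List.getElem_mem _), List.next_getElem _ (hnd d hd)]
    simp only [Nat.mod_eq_of_lt hi]
  · intro x hx y hy
    simp only [Equiv.ofBijective_apply]
    cases d with
    | nil => simp at hx
    | cons a l =>
      simp only [List.head?_cons, Option.mem_def, Option.some.injEq] at hy
      rw [List.getLast?_eq_getElem?] at hx
      simp only [Option.mem_def] at hx
      obtain ⟨hlt, rfl⟩ := List.getElem?_eq_some_iff.1 hx
      rw [hnext _ (List.getElem_mem _), List.next_getElem _ (hnd _ hd)]
      simp [hy]

theorem IsCyc.mono {V : Type*} {A B : V → V → Prop} (h : ∀ a b, A a b → B a b) {c : List V}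
    (hc : IsCyc A c) : IsCyc B c :=
  ⟨hc.1.imp h, fun x hx y hy => h _ _ (hc.2 x hx y hy)⟩

theorem perm_lists {W : Type*} [Fintype W] (σ : Equiv.Perm W) (N : ℕ) : ∀ S : Finset W,
    S.card ≤ N → (∀ v ∈ S, σ v ∈ S) → ∃ C : List (List W), C.flatten.Nodup ∧
      (∀ v, v ∈ C.flatten ↔ v ∈ S) ∧ ∀ c ∈ C, c ≠ [] ∧ IsCyc (fun a b => σ a = b) c := by
  induction N with
  | zero =>
    intro S hS _
    have : S = ∅ := Finset.card_eq_zero.1 (by omega)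
    subst this
    exact ⟨[], by simp⟩
  | succ N ih =>
    intro S hS hcl
    by_cases hE : S = ∅
    · subst hE
      exact ⟨[], by simp⟩
    obtain ⟨x, hx⟩ := Finset.nonempty_iff_ne_empty.2 hE
    set p := Function.minimalPeriod σ x with hp
    have hper : x ∈ Function.periodicPts σ :=
      (Function.Injective.mem_periodicPts σ.injective x)
    have hp0 : 0 < p := Function.minimalPeriod_pos_of_mem_periodicPts hper
    have hpx : σ^[p] x = x := Function.iterate_minimalPeriod
    set o := (List.range p).map (fun i => σ^[i] x) with ho
    have hmo : ∀ v, v ∈ o ↔ ∃ i < p, σ^[i] x = v := by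
      intro v; simp [ho, eq_comm]
    have honod : o.Nodup := by
      refine List.Nodup.map_on ?_ List.nodup_range
      intro i hi j hj hij
      exact (Function.iterate_eq_iterate_iff_of_lt_minimalPeriod
        (List.mem_range.1 hi) (List.mem_range.1 hj)).1 hij
    have hoS : ∀ v ∈ o, v ∈ S := by
      intro v hv
      obtain ⟨i, _, rfl⟩ := (hmo v).1 hv
      clear hv
      rename_i hi
      clear hi
      induction i with
      | zero => simpa using hx
      | succ i ih => rw [Function.iterate_succ_apply']; exact hcl _ ih
    have hxo : x ∈ o := (hmo x).2 ⟨0, hp0, rfl⟩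
    have hprev : ∀ v, σ v ∈ o → v ∈ o := by
      intro v hv
      obtain ⟨i, hi, h⟩ := (hmo _).1 hv
      rw [hmo]
      rcases i with _ | i
      · refine ⟨p - 1, by omega, ?_⟩
        apply σ.injective
        rw [← Function.iterate_succ_apply' (f := σ), ← h]
        have : (p - 1).succ = p := by omega
        rw [this, hpx]; rfl
      · refine ⟨i, by omega, ?_⟩
        apply σ.injective
        rw [← Function.iterate_succ_apply' (f := σ), ← h]
    have hcyc : IsCyc (fun a b => σ a = b) o := by
      constructor
      · rw [ho, List.isChain_map, List.isChain_range]
        intro m _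
        rw [Function.iterate_succ_apply']
      · intro a ha b hb
        have e : p = (p - 1) + 1 := by omega
        rw [ho, e, List.range_succ, List.map_append] at ha
        simp at ha
        rw [ho, e, List.range_succ_eq_map] at hb
        simp at hb
        rw [← ha, ← hb, ← Function.iterate_succ_apply' (f := σ), Nat.succ_eq_add_one, ← e, hpx]
    obtain ⟨C, h1, h2, h3⟩ := ih (S.filter (fun v => v ∉ o)) (by
      have : S.filter (fun v => v ∉ o) ⊂ S := by
        refine Finset.filter_ssubset.2 ⟨x, hx, by simpa using hxo⟩
      have := Finset.card_lt_card this
      omega) (by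
      intro v hv
      rw [Finset.mem_filter] at hv ⊢
      exact ⟨hcl v hv.1, fun h => hv.2 (hprev v h)⟩)
    refine ⟨o :: C, ?_, ?_, ?_⟩
    · rw [List.flatten_cons, List.nodup_append]
      refine ⟨honod, h1, ?_⟩
      rintro a ha b hb rfl
      rw [h2, Finset.mem_filter] at hb
      exact hb.2 ha
    · intro v
      rw [List.flatten_cons, List.mem_append, h2, Finset.mem_filter]
      constructor
      · rintro (h | h)
        · exact hoS v h
        · exact h.1
      · intro h
        by_cases hv : v ∈ o
        · exact Or.inl hv
        · exact Or.inr ⟨h, hv⟩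
    · intro c hc
      rw [List.mem_cons] at hc
      rcases hc with rfl | hc
      · exact ⟨List.ne_nil_of_mem hxo, hcyc⟩
      · exact h3 c hc

theorem exists_cover {W : Type*} [Fintype W] {A : W → W → Prop} (σ : Equiv.Perm W)
    (h : ∀ v, A v (σ v)) : ∃ C, Cover A C := by
  obtain ⟨C, h1, h2, h3⟩ := perm_lists σ _ Finset.univ le_rfl (by simp)
  refine ⟨C, h1, fun v => (h2 v).2 (Finset.mem_univ _), fun c hc => ⟨(h3 c hc).1, ?_⟩⟩
  refine (h3 c hc).2.mono ?_
  rintro a b rfl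
  exact h a

theorem hall_perm {W : Type*} [Fintype W] {A : W → W → Prop} {d : ℝ}
    (hout : ∀ v, d ≤ ((Finset.univ.filter (fun w => A v w)).card : ℝ))
    (hin : ∀ v, d ≤ ((Finset.univ.filter (fun w => A w v)).card : ℝ))
    (harc : ∀ X Y : Finset W, d ≤ (X.card : ℝ) → d ≤ (Y.card : ℝ) →
      ∃ x ∈ X, ∃ y ∈ Y, A x y) :
    ∃ σ : Equiv.Perm W, ∀ v, A v (σ v) := by
  have key := (Finset.all_card_le_biUnion_card_iff_exists_injective
    (fun v : W => Finset.univ.filter (fun w => A v w))).1 (by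
    intro S
    by_contra hlt
    push Not at hlt
    set T := S.biUnion (fun v : W => Finset.univ.filter (fun w => A v w)) with hT
    have hSne : S.Nonempty := by
      rw [← Finset.card_pos]; omega
    obtain ⟨v, hv⟩ := hSne
    have h1 : (Finset.univ.filter (fun w => A v w)).card ≤ T.card :=
      Finset.card_le_card (Finset.subset_biUnion_of_mem
        (fun v : W => Finset.univ.filter (fun w => A v w)) hv)
    have h2 : T.card + Tᶜ.card = Fintype.card W := Finset.card_add_card_compl T
    have h3 : S.card + Sᶜ.card = Fintype.card W := Finset.card_add_card_compl S
    have hTne : (Tᶜ).Nonempty := by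
      rw [← Finset.card_pos]; omega
    obtain ⟨w, hw⟩ := hTne
    have hno : ∀ x ∈ S, ∀ y ∈ Tᶜ, ¬ A x y := by
      intro x hx y hy hA
      rw [Finset.mem_compl] at hy
      exact hy (Finset.mem_biUnion.2 ⟨x, hx, by simpa using hA⟩)
    have h4 : (Finset.univ.filter (fun u => A u w)).card ≤ Sᶜ.card := by
      apply Finset.card_le_card
      intro u hu
      rw [Finset.mem_compl]
      intro huS
      exact hno u huS w hw (by simpa using hu)
    have h5 : d ≤ (S.card : ℝ) := by
      refine (hout v).trans ?_
      exact_mod_cast (by omega)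
    have h6 : d ≤ (Tᶜ.card : ℝ) := by
      refine (hin w).trans ?_
      exact_mod_cast (by omega)
    obtain ⟨x, hx, y, hy, hxy⟩ := harc S Tᶜ h5 h6
    exact hno x hx y hy hxy)
  obtain ⟨f, hf, hfA⟩ := key
  refine ⟨Equiv.ofBijective f (Finite.injective_iff_bijective.1 hf), fun v => ?_⟩
  simpa using hfA v

/-- Among many pairs, one avoids all short `σ`-jumps. -/
theorem exists_far_pair {W : Type*} [Fintype W] (σ : Equiv.Perm W) (L : ℕ) (x : W)
    (G : Finset (W × W)) (hG : 4 * L * Fintype.card W < G.card) :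
    ∃ y z, (y, z) ∈ G ∧ ∀ j < L, σ^[j] y ≠ x ∧ σ^[j] z ≠ x ∧ σ^[j] y ≠ z ∧ σ^[j] z ≠ y := by
  by_contra hcon
  push Not at hcon
  let e : ℕ → Fin 4 → W → W × W := fun j i w =>
    match i with
    | 0 => ((σ^j)⁻¹ x, w)
    | 1 => (w, (σ^j)⁻¹ x)
    | 2 => (w, σ^[j] w)
    | 3 => (σ^[j] w, w)
  have hsub : G ⊆ (Finset.univ : Finset (Fin L × Fin 4 × W)).image
      (fun t => e t.1 t.2.1 t.2.2) := by
    rintro ⟨y, z⟩ hyz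
    obtain ⟨j, hj, h⟩ := hcon y z hyz
    rw [Finset.mem_image]
    by_cases h1 : σ^[j] y = x
    · refine ⟨(⟨j, hj⟩, 0, z), Finset.mem_univ _, ?_⟩
      simp only [e]
      rw [← h1, ← Equiv.Perm.coe_pow]
      simp
    by_cases h2 : σ^[j] z = x
    · refine ⟨(⟨j, hj⟩, 1, y), Finset.mem_univ _, ?_⟩
      simp only [e]
      rw [← h2, ← Equiv.Perm.coe_pow]
      simp
    by_cases h3 : σ^[j] y = z
    · refine ⟨(⟨j, hj⟩, 2, y), Finset.mem_univ _, ?_⟩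
      simp only [e]
      rw [h3]
    · refine ⟨(⟨j, hj⟩, 3, z), Finset.mem_univ _, ?_⟩
      simp only [e]
      rw [h h1 h2 h3]
  have := (Finset.card_le_card hsub).trans Finset.card_image_le
  rw [Finset.card_univ, Fintype.card_prod, Fintype.card_prod, Fintype.card_fin,
    Fintype.card_fin] at this
  nlinarith

theorem last_cons_snoc {W : Type*} (a : W) (l : List W) (z : W) :
    (a :: (l ++ [z])).getLast? = some z := by
  rw [← List.cons_append, List.getLast?_append_of_ne_nil _ (by simp)]; simp

theorem Cover.replace {W : Type*} {A : W → W → Prop} {C D D' R : List (List W)}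
    (hC : Cover A C) (h : C.Perm (D ++ R)) (hD : D'.flatten.Perm D.flatten)
    (hD' : ∀ c ∈ D', c ≠ [] ∧ IsCyc A c) : Cover A (D' ++ R) := by
  have hp : (D' ++ R).flatten.Perm C.flatten := by
    refine List.Perm.trans ?_ h.flatten.symm
    rw [List.flatten_append, List.flatten_append]
    exact hD.append_right _
  refine ⟨hp.nodup_iff.2 hC.1, fun v => hp.mem_iff.2 (hC.2.1 v), ?_⟩
  intro c hc
  rw [List.mem_append] at hc
  rcases hc with hc | hc
  · exact hD' c hc
  · exact hC.2.2 c (h.mem_iff.2 (List.mem_append_right _ hc))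

theorem merge_step {W : Type*} [Fintype W] {A : W → W → Prop} {d : ℝ} {L : ℕ}
    (hout : ∀ v, d ≤ ((Finset.univ.filter (fun w => A v w)).card : ℝ))
    (hin : ∀ v, d ≤ ((Finset.univ.filter (fun w => A w v)).card : ℝ))
    (harc : ∀ X Y : Finset W, d ≤ (X.card : ℝ) → d ≤ (Y.card : ℝ) →
      4 * L * Fintype.card W < ((X ×ˢ Y).filter (fun p => A p.1 p.2)).card)
    {C : List (List W)} (hC : Cover A C) {c₀ : List W} (hc₀ : c₀ ∈ C) (hlen : c₀.length < L) :
    ∃ C', Cover A C' ∧ C'.countP (fun c => decide (c.length < L)) <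
      C.countP (fun c => decide (c.length < L)) := by
  obtain ⟨σ, hσ⟩ := exists_perm hC.1 hC.2.1
  obtain ⟨hne0, hcyc0⟩ := hC.2.2 c₀ hc₀
  have hσ0 := hσ c₀ hc₀
  obtain ⟨x, hx⟩ : ∃ x, c₀.getLast? = some x := ⟨_, List.getLast?_eq_getLast_of_ne_nil hne0⟩
  obtain ⟨hd0, hhd0⟩ : ∃ x, c₀.head? = some x := ⟨_, List.head?_eq_some_head hne0⟩
  have e0 : σ x = hd0 := hσ0.2 x hx hd0 hhd0
  -- the pairs
  set X := Finset.univ.filter (fun y => A x (σ y)) with hX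
  set Y := Finset.univ.filter (fun w => A (σ.symm w) (σ x)) with hY
  have hXc : d ≤ (X.card : ℝ) := by
    refine (hout x).trans_eq ?_
    congr 1
    symm
    refine Finset.card_bij (fun y _ => σ y) ?_ ?_ ?_
    · intro a ha; simpa [hX] using ha
    · intro a _ b _ h; exact σ.injective h
    · intro b hb; exact ⟨σ.symm b, by simpa [hX] using hb, by simp⟩
  have hYc : d ≤ (Y.card : ℝ) := by
    refine (hin (σ x)).trans_eq ?_
    congr 1
    refine Finset.card_bij (fun y _ => σ y) ?_ ?_ ?_
    · intro a ha; simpa [hY] using ha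
    · intro a _ b _ h; exact σ.injective h
    · intro b hb; exact ⟨σ.symm b, by simpa [hY] using hb, by simp⟩
  have hK := harc X Y hXc hYc
  set G := ((X ×ˢ Y).filter (fun p => A p.1 p.2)).image (fun p => (p.1, σ.symm p.2)) with hG
  have hGc : G.card = ((X ×ˢ Y).filter (fun p => A p.1 p.2)).card := by
    apply Finset.card_image_of_injective
    rintro ⟨a, b⟩ ⟨a', b'⟩ h
    simpa using h
  obtain ⟨y, z, hyz, hfar⟩ := exists_far_pair σ L x G (by rw [hGc]; exact hK)
  have hL : 0 < L := by omega
  obtain ⟨hxy, hyz', hzx⟩ : A x (σ y) ∧ A y (σ z) ∧ A z (σ x) := by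
    rw [hG, Finset.mem_image] at hyz
    obtain ⟨⟨a, b⟩, hab, h⟩ := hyz
    simp only [hX, hY, Finset.mem_filter, Finset.mem_product, Finset.mem_univ, true_and] at hab
    simp only [Prod.mk.injEq] at h
    obtain ⟨rfl, rfl⟩ := h
    refine ⟨hab.1.1, by simpa using hab.2, hab.1.2⟩
  obtain ⟨c₁, hc₁, hy₁⟩ := List.mem_flatten.1 (hC.2.1 y)
  obtain ⟨c₂, hc₂, hz₂⟩ := List.mem_flatten.1 (hC.2.1 z)
  have hne1 : c₁ ≠ c₀ := by
    rintro rfl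
    obtain ⟨j, hj, h⟩ := cyc_reach hσ0 hx hy₁
    exact (hfar j (by omega)).1 h
  have hne2 : c₂ ≠ c₀ := by
    rintro rfl
    obtain ⟨j, hj, h⟩ := cyc_reach hσ0 hx hz₂
    exact (hfar j (by omega)).2.1 h
  have hc₁' : c₁ ∈ C.erase c₀ := (List.mem_erase_of_ne hne1).2 hc₁
  have hp0 := List.perm_cons_erase hc₀
  have hp1 := List.perm_cons_erase hc₁'
  obtain ⟨l₂, hl₂p, hl₂c⟩ := exists_rot hz₂
  by_cases h12 : c₁ = c₂
  · subst h12
    have hyne : y ≠ z := (hfar 0 hL).2.2.1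
    have hyl : y ∈ l₂ := by
      have := hl₂p.mem_iff.2 hy₁
      simpa [hyne] using this
    obtain ⟨p, q, rfl⟩ := List.append_of_mem hyl
    have hA := hl₂c _ (hC.2.2 _ hc₁).2
    have hS := hl₂c _ (hσ _ hc₁)
    have ereassoc : p ++ y :: q ++ [z] = (p ++ [y]) ++ (q ++ [z]) := by simp
    rw [ereassoc] at hA hS hl₂p
    obtain ⟨hA1, hA2, hA3⟩ := List.isChain_append.1 hA.1
    obtain ⟨hS1, hS2, hS3⟩ := List.isChain_append.1 hS.1
    -- lengths
    have len2 : L ≤ (q ++ [z]).length := by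
      by_contra hlt
      push Not at hlt
      refine (hfar _ hlt).2.2.1 (chain_iter σ _ _ _ ?_ (last_cons_snoc _ _ _))
      have h := hS.1
      rw [← ereassoc] at h
      have : p ++ y :: q ++ [z] = p ++ (y :: (q ++ [z])) := by simp
      rw [this] at h
      exact (List.isChain_append.1 h).2.1
    have len1 : L ≤ (p ++ [y]).length := by
      by_contra hlt
      push Not at hlt
      refine (hfar _ hlt).2.2.2 (chain_iter σ _ _ _ ?_ (last_cons_snoc _ _ _))
      have h := hS.rot.1
      have : q ++ [z] ++ (p ++ [y]) = q ++ (z :: (p ++ [y])) := by simp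
      rw [this] at h
      exact (List.isChain_append.1 h).2.1
    have hheadq : ∀ w ∈ (q ++ [z]).head?, w = σ y := by
      intro w hw
      exact (hS3 y (by simp) w hw).symm
    have hheadp : ∀ w ∈ (p ++ [y]).head?, w = σ z := by
      intro w hw
      refine (hS.2 z (by rw [List.getLast?_append_of_ne_nil _ (by simp)]; simp) w ?_).symm
      rwa [List.head?_append_of_ne_nil _ (by simp)]
    refine ⟨[c₀ ++ (q ++ [z]), p ++ [y]] ++ (C.erase c₀).erase c₁, ?_, ?_⟩
    · refine hC.replace (D := [c₀, c₁]) (hp0.trans (hp1.cons _)) ?_ ?_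
      · simp only [List.flatten_cons, List.flatten_nil, List.append_nil, List.append_assoc]
        refine List.Perm.append_left _ ?_
        refine List.Perm.trans ?_ hl₂p
        simpa using List.perm_append_comm (l₁ := q ++ [z]) (l₂ := p ++ [y])
      · intro c hc
        simp only [List.mem_cons, List.not_mem_nil, or_false] at hc
        rcases hc with rfl | rfl
        · refine ⟨by simp, IsCyc.append hcyc0.1 hA2 hne0 (by simp) ?_ ?_⟩
          · intro a ha b hb
            rw [hx] at ha
            simp only [Option.mem_def, Option.some.injEq] at ha
            rw [← ha, hheadq b hb]; exact hxy
          · intro a ha b hb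
            rw [hhd0] at hb
            simp only [Option.mem_def, Option.some.injEq, List.getLast?_append, List.getLast?_singleton, Option.some_or] at ha hb
            rw [← ha, ← hb, ← e0]; exact hzx
        · refine ⟨by simp, hA1, ?_⟩
          intro a ha b hb
          rw [hheadp b hb]
          simp only [Option.mem_def, Option.some.injEq, List.getLast?_append, List.getLast?_singleton, Option.some_or] at ha
          rw [← ha]; exact hyz'
    · rw [(hp0.trans (hp1.cons _)).countP_eq]
      have n1 : ¬ ((c₀ ++ (q ++ [z])).length < L) := by rw [List.length_append]; omega
      have n2 : ¬ ((p ++ [y]).length < L) := by omega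
      simp only [List.cons_append, List.nil_append, List.countP_cons, n1, n2, hlen, decide_true, decide_false]
      simp
  · have hc₂' : c₂ ∈ (C.erase c₀).erase c₁ :=
      (List.mem_erase_of_ne (Ne.symm h12)).2 ((List.mem_erase_of_ne hne2).2 hc₂)
    have hp2 := List.perm_cons_erase hc₂'
    have hp := hp0.trans ((hp1.trans (hp2.cons _)).cons _)
    obtain ⟨l₁, hl₁p, hl₁c⟩ := exists_rot hy₁
    have hA1 := hl₁c _ (hC.2.2 _ hc₁).2
    have hS1 := hl₁c _ (hσ _ hc₁)
    have hA2 := hl₂c _ (hC.2.2 _ hc₂).2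
    have hS2 := hl₂c _ (hσ _ hc₂)
    refine ⟨[c₀ ++ ((l₁ ++ [y]) ++ (l₂ ++ [z]))] ++ ((C.erase c₀).erase c₁).erase c₂, ?_, ?_⟩
    · refine hC.replace (D := [c₀, c₁, c₂]) hp ?_ ?_
      · simp only [List.flatten_cons, List.flatten_nil, List.append_nil]
        exact List.Perm.append_left _ (hl₁p.append hl₂p)
      · intro c hc
        simp only [List.mem_cons, List.not_mem_nil, or_false] at hc
        subst hc
        refine ⟨by simp, IsCyc.append hcyc0.1 (List.isChain_append.2 ⟨hA1.1, hA2.1, ?_⟩)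
          hne0 (by simp) ?_ ?_⟩
        · intro a ha b hb
          have := hS2.2 z (by simp) b hb
          simp only [Option.mem_def, Option.some.injEq, List.getLast?_append, List.getLast?_singleton, Option.some_or] at ha
          rw [← ha, ← this]; exact hyz'
        · intro a ha b hb
          rw [List.head?_append_of_ne_nil _ (by simp)] at hb
          have := hS1.2 y (by simp) b hb
          rw [hx] at ha
          simp only [Option.mem_def, Option.some.injEq] at ha
          rw [← ha, ← this]; exact hxy
        · intro a ha b hb
          rw [hhd0] at hb
          simp only [Option.mem_def, Option.some.injEq, List.getLast?_append, List.getLast?_singleton, Option.some_or] at ha hb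
          rw [← ha, ← hb, ← e0]; exact hzx
    · rw [hp.countP_eq]
      have n1 : (c₀ ++ ((l₁ ++ [y]) ++ (l₂ ++ [z]))).length = c₀.length + (c₁.length + c₂.length) := by
        rw [List.length_append, List.length_append, hl₁p.length_eq, hl₂p.length_eq]
      simp only [List.cons_append, List.nil_append, List.countP_cons, decide_eq_true_eq] at n1 ⊢
      rw [n1]
      split_ifs <;> omega

theorem long_cover {W : Type*} [Fintype W] {A : W → W → Prop} {d : ℝ} {L : ℕ}
    (hout : ∀ v, d ≤ ((Finset.univ.filter (fun w => A v w)).card : ℝ))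
    (hin : ∀ v, d ≤ ((Finset.univ.filter (fun w => A w v)).card : ℝ))
    (harc : ∀ X Y : Finset W, d ≤ (X.card : ℝ) → d ≤ (Y.card : ℝ) →
      4 * L * Fintype.card W < ((X ×ˢ Y).filter (fun p => A p.1 p.2)).card) :
    ∃ C, Cover A C ∧ ∀ c ∈ C, L ≤ c.length := by
  obtain ⟨σ, hσ⟩ := hall_perm hout hin (by
    intro X Y hX hY
    have h := harc X Y hX hY
    have h0 : 0 < ((X ×ˢ Y).filter (fun p => A p.1 p.2)).card := by omega
    obtain ⟨⟨a, b⟩, hab⟩ := Finset.card_pos.1 h0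
    simp only [Finset.mem_filter, Finset.mem_product] at hab
    exact ⟨a, hab.1.1, b, hab.1.2, hab.2⟩)
  have hex : ∃ N, ∃ C, Cover A C ∧ C.countP (fun c => decide (c.length < L)) = N := by
    obtain ⟨C, hC⟩ := exists_cover σ hσ
    exact ⟨_, C, hC, rfl⟩
  obtain ⟨C, hC, hN⟩ := Nat.find_spec hex
  refine ⟨C, hC, ?_⟩
  by_contra hcon
  push Not at hcon
  obtain ⟨c, hc, hlt⟩ := hcon
  obtain ⟨C', hC', hlt'⟩ := merge_step hout hin harc hC hc hlt
  exact Nat.find_min hex (hN ▸ hlt') ⟨C', hC', rfl⟩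

/-- `S` (with ends `s`, `t`) can absorb any `j` paths and, additionally, one path whose pair of
ends is not in `R`. -/
def Absb {V : Type*} (A : V → V → Prop) (S : List V) (s t : V) (j : ℕ) (R : Finset (V × V)) : Prop :=
  ∀ C : List (List V), (∀ c ∈ C, ∃ s' t', IsPath A s' t' c) →
    (C.length ≤ j ∨ ∃ c C' s' t', C = c :: C' ∧ IsPath A s' t' c ∧ (s', t') ∉ R ∧ C'.length ≤ j) →
    ∃ p, IsPath A s t p ∧ p.Perm (S ++ C.flatten)

theorem isPath_singleton {V : Type*} {A : V → V → Prop} (a : V) : IsPath A a a [a] := by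
  simp [IsPath]

theorem Absb.step {V : Type*} {A : V → V → Prop} {S : List V} {s t : V} {j : ℕ}
    {R : Finset (V × V)} (h : Absb A S s t j R) {u v a b : V} (h1 : A t u) (h2 : A u v) (h3 : A v a)
    (h4 : A a b) :
    Absb A (S ++ [u, v, a, b]) s b j (R.filter (fun p => ¬ (A a p.1 ∧ A p.2 b))) := by
  have huv : IsPath A u a ([u] ++ ([v] ++ [a])) :=
    (isPath_singleton u).append ((isPath_singleton v).append (isPath_singleton a) h3) h2
  have huvab : IsPath A u b ([u] ++ ([v] ++ [a]) ++ [b]) := huv.append (isPath_singleton b) h4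
  have old : ∀ C : List (List V), (∃ p, IsPath A s t p ∧ p.Perm (S ++ C.flatten)) →
      ∃ p, IsPath A s b p ∧ p.Perm (S ++ [u, v, a, b] ++ C.flatten) := by
    rintro C ⟨p, hp, hpp⟩
    refine ⟨p ++ ([u] ++ ([v] ++ [a]) ++ [b]), hp.append huvab h1, ?_⟩
    refine (hpp.append_right _).trans ?_
    rw [List.perm_iff_count]
    intro x
    simp only [List.count_append, List.count_cons, List.count_nil]
    omega
  intro C hC hCR
  rcases hCR with hlen | ⟨c, C', s', t', rfl, hc, hR, hlen⟩
  · exact old C (h C hC (Or.inl hlen))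
  · by_cases hmem : (s', t') ∈ R
    · rw [Finset.mem_filter] at hR
      push Not at hR
      obtain ⟨ha, hb⟩ := hR hmem
      obtain ⟨p, hp, hpp⟩ := h C' (fun c hc => hC c (List.mem_cons_of_mem _ hc)) (Or.inl hlen)
      refine ⟨p ++ (([u] ++ ([v] ++ [a])) ++ (c ++ [b])),
        hp.append (huv.append (hc.append (isPath_singleton b) hb) ha) h1, ?_⟩
      refine (hpp.append_right _).trans ?_
      rw [List.flatten_cons, List.perm_iff_count]
      intro x
      simp only [List.count_append, List.count_cons, List.count_nil]
      omega
    · exact old _ (h _ hC (Or.inr ⟨c, C', s', t', rfl, hc, hmem, hlen⟩))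

/-- The nonextremality hypotheses. -/
structure Good {V : Type*} [Fintype V] (A : V → V → Prop) (ε : ℝ) : Prop where
  irr : ∀ v, ¬ A v v
  out : ∀ v, (Fintype.card V : ℝ) / 2 ≤ ((Finset.univ.filter (fun w => A v w)).card : ℝ)
  inn : ∀ v, (Fintype.card V : ℝ) / 2 ≤ ((Finset.univ.filter (fun w => A w v)).card : ℝ)
  arc : ∀ X Y : Finset V, (1 / 2 - ε) * Fintype.card V ≤ (X.card : ℝ) →
    (1 / 2 - ε) * Fintype.card V ≤ (Y.card : ℝ) →
    (ε * Fintype.card V) ^ 2 < (((X ×ˢ Y).filter (fun p => A p.1 p.2)).card : ℝ)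

theorem card_sdiff_ge {V : Type*} [Fintype V] {ε : ℝ} {N F : Finset V}
    (hN : (Fintype.card V : ℝ) / 2 ≤ N.card) (hF : (F.card : ℝ) ≤ ε * Fintype.card V) :
    (1 / 2 - ε) * Fintype.card V ≤ ((N \ F).card : ℝ) := by
  have h : N.card ≤ (N \ F).card + F.card := by
    have := Finset.le_card_sdiff F N
    omega
  have h' : (N.card : ℝ) ≤ (N \ F).card + F.card := by exact_mod_cast h
  linarith

theorem Good.conn {V : Type*} [Fintype V] {A : V → V → Prop} {ε : ℝ} (h : Good A ε)
    {F : Finset V} (hF : (F.card : ℝ) ≤ ε * Fintype.card V) (x y : V) :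
    ∃ a b, a ∉ F ∧ b ∉ F ∧ A x a ∧ A a b ∧ A b y := by
  have := h.arc _ _ (card_sdiff_ge (h.out x) hF) (card_sdiff_ge (h.inn y) hF)
  have h0 := lt_of_le_of_lt (sq_nonneg _) this
  have h1 := Nat.cast_pos.1 h0
  obtain ⟨⟨a, b⟩, hab⟩ := Finset.card_pos.1 h1
  simp only [Finset.mem_filter, Finset.mem_product, Finset.mem_sdiff, Finset.mem_univ,
    true_and] at hab
  exact ⟨a, b, hab.1.1.2, hab.1.2.2, hab.1.1.1, hab.2, hab.1.2.1⟩

theorem Good.greedy {V : Type*} [Fintype V] [Nonempty V] {A : V → V → Prop} {ε : ℝ}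
    (h : Good A ε) {F : Finset V} (hF : (F.card : ℝ) ≤ ε * Fintype.card V)
    (R : Finset (V × V)) :
    ∃ a b, a ∉ F ∧ b ∉ F ∧ A a b ∧
      ((R.filter (fun p => ¬ (A a p.1 ∧ A p.2 b))).card : ℝ) ≤ (1 - ε ^ 2) * R.card := by
  by_cases hR : R = ∅
  · obtain ⟨x⟩ := ‹Nonempty V›
    obtain ⟨a, b, ha, hb, -, hab, -⟩ := h.conn hF x x
    exact ⟨a, b, ha, hb, hab, by simp [hR]⟩
  by_contra hcon0
  have hcon : ∀ a b, a ∉ F → b ∉ F → A a b → (1 - ε ^ 2) * R.card <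
      ((R.filter (fun p => ¬ (A a p.1 ∧ A p.2 b))).card : ℝ) :=
    fun a b ha hb hab => lt_of_not_ge fun hle => hcon0 ⟨a, b, ha, hb, hab, hle⟩
  set E := (Finset.univ : Finset (V × V)).filter (fun e => e.1 ∉ F ∧ e.2 ∉ F ∧ A e.1 e.2) with hE
  have hR0 : R.Nonempty := Finset.nonempty_iff_ne_empty.2 hR
  have h1 : ∀ p ∈ R, (ε * Fintype.card V) ^ 2 <
      ((E.filter (fun e => A e.1 p.1 ∧ A p.2 e.2)).card : ℝ) := by
    intro p _
    refine (h.arc _ _ (card_sdiff_ge (h.inn p.1) hF) (card_sdiff_ge (h.out p.2) hF)).trans_le ?_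
    norm_cast
    apply Finset.card_le_card
    rintro ⟨a, b⟩ hab
    simp only [Finset.mem_filter, Finset.mem_product, Finset.mem_sdiff, Finset.mem_univ,
      true_and, hE] at hab ⊢
    tauto
  have h2 : ∀ e ∈ E, ((R.filter (fun p => A e.1 p.1 ∧ A p.2 e.2)).card : ℝ) ≤ ε ^ 2 * R.card := by
    intro e he
    simp only [hE, Finset.mem_filter, Finset.mem_univ, true_and] at he
    have h3 := hcon e.1 e.2 he.1 he.2.1 he.2.2
    have h4 := Finset.card_filter_add_card_filter_not (s := R) (fun p => A e.1 p.1 ∧ A p.2 e.2)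
    have h5 : ((R.filter (fun p => A e.1 p.1 ∧ A p.2 e.2)).card : ℝ) +
      (R.filter (fun p => ¬ (A e.1 p.1 ∧ A p.2 e.2))).card = R.card := by exact_mod_cast h4
    linarith
  have h3 : ∑ p ∈ R, ((E.filter (fun e => A e.1 p.1 ∧ A p.2 e.2)).card : ℝ) =
      ∑ e ∈ E, ((R.filter (fun p => A e.1 p.1 ∧ A p.2 e.2)).card : ℝ) := by
    simp only [Finset.card_filter, Nat.cast_sum]
    rw [Finset.sum_comm]
  have h4 := Finset.sum_lt_sum_of_nonempty hR0 h1
  have h5 := Finset.sum_le_sum h2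
  rw [h3] at h4
  have h6 := h4.trans_le h5
  rw [Finset.sum_const, Finset.sum_const, nsmul_eq_mul, nsmul_eq_mul] at h6
  have h7 : (E.card : ℝ) ≤ (Fintype.card V : ℝ) ^ 2 := by
    have := Finset.card_le_univ E
    rw [Fintype.card_prod, ← sq] at this
    exact_mod_cast this
  have h8 : (E.card : ℝ) * (ε ^ 2 * R.card) ≤ (Fintype.card V : ℝ) ^ 2 * (ε ^ 2 * R.card) :=
    mul_le_mul_of_nonneg_right h7 (by positivity)
  have : (R.card : ℝ) * (ε * Fintype.card V) ^ 2 = (Fintype.card V : ℝ) ^ 2 * (ε ^ 2 * R.card) := by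
    ring
  linarith

def AbsInv {V : Type*} (A : V → V → Prop) (U : Finset V) (S : List V) (s t : V) (j : ℕ)
    (R : Finset (V × V)) : Prop :=
  Absb A S s t j R ∧ S.Nodup ∧ ∀ x ∈ S, x ∉ U

theorem AbsInv.step {V : Type*} [Fintype V] [Nonempty V] {A : V → V → Prop} {ε : ℝ} (h : Good A ε)
    {U : Finset V} {S : List V} {s t : V} {j : ℕ} {R : Finset (V × V)} (hI : AbsInv A U S s t j R)
    (hc : (U.card : ℝ) + S.length + 2 ≤ ε * Fintype.card V) :
    ∃ S' t' R', AbsInv A U S' s t' j R' ∧ S'.length = S.length + 4 ∧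
      (R'.card : ℝ) ≤ (1 - ε ^ 2) * R.card := by
  obtain ⟨hAb, hnd, hU⟩ := hI
  have hcard : (U ∪ S.toFinset).card ≤ U.card + S.length :=
    (Finset.card_union_le _ _).trans (Nat.add_le_add_left (List.toFinset_card_le S) _)
  have hcard' : ((U ∪ S.toFinset).card : ℝ) ≤ U.card + S.length := by exact_mod_cast hcard
  obtain ⟨a, b, ha, hb, hab, hR⟩ := h.greedy (F := U ∪ S.toFinset) (by linarith) R
  have hcard2 : (insert a (insert b (U ∪ S.toFinset))).card ≤ U.card + S.length + 2 := by
    have h1 := Finset.card_insert_le a (insert b (U ∪ S.toFinset))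
    have h2 := Finset.card_insert_le b (U ∪ S.toFinset)
    omega
  have hcard2' : ((insert a (insert b (U ∪ S.toFinset))).card : ℝ) ≤ U.card + S.length + 2 := by
    exact_mod_cast hcard2
  obtain ⟨u, v, hu, hv, h1, h2, h3⟩ := h.conn (hcard2'.trans hc) t a
  refine ⟨_, _, _, ⟨hAb.step h1 h2 h3 hab, ?_, ?_⟩, by simp, hR⟩
  · have huv : u ≠ v := by rintro rfl; exact h.irr _ h2
    have habne : a ≠ b := by rintro rfl; exact h.irr _ hab
    simp only [Finset.mem_insert, Finset.mem_union, List.mem_toFinset, not_or] at ha hb hu hv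
    rw [List.nodup_append]
    refine ⟨hnd, ?_, ?_⟩
    · simp only [List.nodup_cons, List.mem_cons, List.not_mem_nil, or_false, not_or,
        not_false_eq_true, List.nodup_nil, and_true]
      tauto
    · intro x hx y hy
      simp only [List.mem_cons, List.not_mem_nil, or_false] at hy
      rintro rfl
      rcases hy with rfl | rfl | rfl | rfl <;> tauto
  · simp only [Finset.mem_insert, Finset.mem_union, List.mem_toFinset, not_or] at ha hb hu hv
    intro x hx
    simp only [List.mem_append, List.mem_cons, List.not_mem_nil, or_false] at hx
    rcases hx with hx | rfl | rfl | rfl | rfl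
    · exact hU x hx
    all_goals tauto

theorem AbsInv.steps {V : Type*} [Fintype V] [Nonempty V] {A : V → V → Prop} {ε : ℝ} (h : Good A ε)
    (hε : ε ^ 2 ≤ 1)
    {U : Finset V} {S : List V} {s t : V} {j : ℕ} {R : Finset (V × V)} (hI : AbsInv A U S s t j R)
    (T : ℕ) : (U.card : ℝ) + S.length + 4 * T + 2 ≤ ε * Fintype.card V →
    ∃ S' t' R', AbsInv A U S' s t' j R' ∧ S'.length = S.length + 4 * T ∧
      (R'.card : ℝ) ≤ (1 - ε ^ 2) ^ T * R.card := by
  induction T with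
  | zero => intro _; exact ⟨S, t, R, hI, by simp, by simp⟩
  | succ T ih =>
    intro hc
    push_cast at hc
    obtain ⟨S', t', R', hI', hl, hR⟩ := ih (by linarith)
    obtain ⟨S'', t'', R'', hI'', hl', hR'⟩ := hI'.step h (by rw [hl]; push_cast; linarith)
    refine ⟨S'', t'', R'', hI'', by omega, hR'.trans ?_⟩
    rw [show (1 - ε ^ 2) ^ (T + 1) = (1 - ε ^ 2) * (1 - ε ^ 2) ^ T from pow_succ' _ _, mul_assoc]
    exact mul_le_mul_of_nonneg_left hR (by linarith)

theorem AbsInv.level {V : Type*} [Fintype V] [Nonempty V] {A : V → V → Prop} {ε : ℝ} (h : Good A ε)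
    (hε : ε ^ 2 ≤ 1) {U : Finset V} {s : V} (hs : s ∉ U) (T : ℕ)
    (hT : (1 - ε ^ 2) ^ T * (Fintype.card V : ℝ) ^ 2 < 1) (k : ℕ) :
    (U.card : ℝ) + 1 + 4 * (T * k) + 2 ≤ ε * Fintype.card V →
    ∃ S t, AbsInv A U S s t k Finset.univ ∧ S.length = 1 + 4 * (T * k) := by
  induction k with
  | zero =>
    intro _
    refine ⟨[s], s, ⟨?_, by simp, by simpa using hs⟩, by simp⟩
    intro C _ hC
    rcases hC with hC | ⟨_, _, _, _, _, _, h, _⟩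
    · have : C = [] := List.length_eq_zero_iff.1 (by omega)
      subst this
      exact ⟨[s], isPath_singleton s, by simp⟩
    · exact absurd (Finset.mem_univ _) h
  | succ k ih =>
    intro hc
    push_cast at hc
    have hT0 : (0 : ℝ) ≤ T := Nat.cast_nonneg T
    obtain ⟨S, t, hI, hl⟩ := ih (by linarith)
    obtain ⟨S', t', R', hI', hl', hR'⟩ := hI.steps h hε T (by rw [hl]; push_cast; linarith)
    have hR0 : R' = ∅ := by
      rw [Finset.card_univ, Fintype.card_prod] at hR'
      push_cast at hR'
      rw [← sq] at hR'
      have : (R'.card : ℝ) < 1 := lt_of_le_of_lt hR' hT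
      have : R'.card < 1 := by exact_mod_cast this
      exact Finset.card_eq_zero.1 (by omega)
    subst hR0
    refine ⟨S', t', ⟨?_, hI'.2⟩, by rw [hl', hl]; ring⟩
    intro C hC hC'
    rcases hC' with hC' | ⟨_, _, _, _, _, _, h, _⟩
    · cases C with
      | nil => exact hI'.1 [] hC (Or.inl (by simp))
      | cons c C =>
        obtain ⟨s', t'', hp⟩ := hC c (by simp)
        exact hI'.1 _ hC (Or.inr ⟨c, C, s', t'', rfl, hp, by simp, by simpa using hC'⟩)
    · exact absurd (Finset.mem_univ _) h

theorem card_sub_filter {V : Type*} [Fintype V] (F : Finset V) (P : V → Prop) :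
    ((Finset.univ : Finset {v // v ∉ F}).filter (fun w => P w.1)).card =
      ((Finset.univ.filter P) \ F).card := by
  rw [← Finset.card_map (Function.Embedding.subtype _)]
  congr 1
  ext x
  simp only [Finset.mem_map, Finset.mem_filter, Finset.mem_univ, true_and,
    Function.Embedding.subtype_apply, Subtype.exists, Finset.mem_sdiff]
  constructor
  · rintro ⟨a, ha, hP, rfl⟩
    exact ⟨hP, ha⟩
  · rintro ⟨hP, ha⟩
    exact ⟨x, ha, hP, rfl⟩

theorem Good.cover {V : Type*} [Fintype V] {A : V → V → Prop} {ε : ℝ} (h : Good A ε)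
    {F : Finset V} (hF : (F.card : ℝ) ≤ ε * Fintype.card V) {L : ℕ}
    (hL : 4 * (L : ℝ) * Fintype.card V ≤ (ε * Fintype.card V) ^ 2) :
    ∃ C : List (List V), C.flatten.Nodup ∧ (∀ v, v ∈ C.flatten ↔ v ∉ F) ∧
      ∀ c ∈ C, L ≤ c.length ∧ ∃ s t, IsPath A s t c := by
  obtain ⟨C, ⟨hnd, hmem, hC⟩, hlen⟩ := long_cover (W := {v // v ∉ F})
    (A := fun a b => A a.1 b.1) (d := (1 / 2 - ε) * Fintype.card V) (L := L)
    (fun v => by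
      rw [card_sub_filter F (fun w => A v.1 w)]
      exact card_sdiff_ge (h.out v.1) hF)
    (fun v => by
      rw [card_sub_filter F (fun w => A w v.1)]
      exact card_sdiff_ge (h.inn v.1) hF)
    (fun X Y hX hY => by
      have h1 := h.arc (X.map (Function.Embedding.subtype _)) (Y.map (Function.Embedding.subtype _))
        (by rwa [Finset.card_map]) (by rwa [Finset.card_map])
      have h2 : (((X.map (Function.Embedding.subtype _)) ×ˢ
          (Y.map (Function.Embedding.subtype _))).filter (fun p => A p.1 p.2)).card ≤
          ((X ×ˢ Y).filter (fun p => A p.1.1 p.2.1)).card := by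
        refine (Finset.card_le_card ?_).trans (Finset.card_image_le
          (f := fun p : {v // v ∉ F} × {v // v ∉ F} => (p.1.1, p.2.1)))
        rintro ⟨a, b⟩ hab
        simp only [Finset.mem_filter, Finset.mem_product, Finset.mem_map,
          Function.Embedding.subtype_apply] at hab
        obtain ⟨⟨⟨a', ha', rfl⟩, ⟨b', hb', rfl⟩⟩, hab⟩ := hab
        exact Finset.mem_image.2 ⟨(a', b'), by simp [ha', hb', hab], rfl⟩
      have h3 : Fintype.card {v // v ∉ F} ≤ Fintype.card V := Fintype.card_subtype_le _
      have h4 : 4 * L * Fintype.card {v // v ∉ F} ≤ 4 * L * Fintype.card V :=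
        Nat.mul_le_mul_left _ h3
      have h5 : ((4 * L * Fintype.card V : ℕ) : ℝ) < (((X.map (Function.Embedding.subtype _)) ×ˢ
          (Y.map (Function.Embedding.subtype _))).filter (fun p => A p.1 p.2)).card := by
        push_cast
        exact lt_of_le_of_lt hL h1
      exact lt_of_le_of_lt h4 (lt_of_lt_of_le (Nat.cast_lt.1 h5) h2))
  have hfl : (C.map (List.map Subtype.val)).flatten = C.flatten.map Subtype.val :=
    List.map_flatten.symm
  refine ⟨C.map (List.map Subtype.val), ?_, ?_, ?_⟩
  · rw [hfl]
    exact hnd.map Subtype.val_injective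
  · intro v
    rw [hfl, List.mem_map]
    constructor
    · rintro ⟨a, -, rfl⟩
      exact a.2
    · intro hv
      exact ⟨⟨v, hv⟩, hmem _, rfl⟩
  · intro c hc
    obtain ⟨c', hc', rfl⟩ := List.mem_map.1 hc
    refine ⟨by simpa using hlen c' hc', ?_⟩
    have hne : c'.map Subtype.val ≠ [] := fun hnil => (hC c' hc').1 (List.map_eq_nil_iff.1 hnil)
    refine ⟨_, _, ?_, List.head?_eq_some_head hne, List.getLast?_eq_some_getLast hne⟩
    rw [List.isChain_map]
    exact (hC c' hc').2.1

theorem length_mul_le_flatten {V : Type*} {L : ℕ} (C : List (List V))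
    (h : ∀ c ∈ C, L ≤ c.length) : C.length * L ≤ C.flatten.length := by
  induction C with
  | nil => simp
  | cons c C ih =>
    have h1 := ih (fun d hd => h d (List.mem_cons_of_mem _ hd))
    have h2 := h c (by simp)
    simp only [List.length_cons, List.flatten_cons, List.length_append, Nat.add_mul, Nat.one_mul]
    omega

theorem Good.hamilton {V : Type*} [Fintype V] {A : V → V → Prop} {ε : ℝ} (h : Good A ε)
    (hε : ε ^ 2 ≤ 1) {U : Finset V} {s : V} (hs : s ∉ U) (T K L : ℕ)
    (hT : (1 - ε ^ 2) ^ T * (Fintype.card V : ℝ) ^ 2 < 1)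
    (hc : (U.card : ℝ) + 1 + 4 * (T * K) + 2 ≤ ε * Fintype.card V)
    (hL : 4 * (L : ℝ) * Fintype.card V ≤ (ε * Fintype.card V) ^ 2)
    (hK : Fintype.card V < (K + 1) * L) :
    ∃ c : List V, c.Nodup ∧ (∀ v : V, v ∈ c ↔ v ∉ U) ∧ c.IsChain A ∧
      ∀ h : c ≠ [], A (c.getLast h) (c.head h) := by
  haveI : Nonempty V := ⟨s⟩
  obtain ⟨S, t, ⟨hAb, hSnd, hSU⟩, hSl⟩ := AbsInv.level h hε hs T hT K hc
  have hcard : (U ∪ S.toFinset).card ≤ U.card + S.length :=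
    (Finset.card_union_le _ _).trans (Nat.add_le_add_left (List.toFinset_card_le S) _)
  have hcard' : ((U ∪ S.toFinset).card : ℝ) ≤ U.card + (1 + 4 * (T * K)) := by
    rw [hSl] at hcard; exact_mod_cast hcard
  obtain ⟨u, v, hu, hv, htu, huv, hvs⟩ := h.conn (F := U ∪ S.toFinset) (by linarith) t s
  have hcard2 : (insert u (insert v (U ∪ S.toFinset))).card ≤ U.card + (1 + 4 * (T * K)) + 2 := by
    have h1 := Finset.card_insert_le u (insert v (U ∪ S.toFinset))
    have h2 := Finset.card_insert_le v (U ∪ S.toFinset)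
    omega
  have hcard2' : ((insert u (insert v (U ∪ S.toFinset))).card : ℝ) ≤
      U.card + (1 + 4 * (T * K)) + 2 := by
    exact_mod_cast hcard2
  obtain ⟨C, hCnd, hCm, hC⟩ := h.cover (F := insert u (insert v (U ∪ S.toFinset)))
    (by linarith) hL
  have hCl : C.length ≤ K := by
    have h1 := length_mul_le_flatten C (fun c hc => (hC c hc).1)
    have h2 : C.flatten.length ≤ Fintype.card V := hCnd.length_le_card
    have h3 : C.length * L < (K + 1) * L := by omega
    have := Nat.lt_of_mul_lt_mul_right h3
    omega
  obtain ⟨p, hp, hpp⟩ := hAb C (fun c hc => (hC c hc).2) (Or.inl hCl)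
  have huvp : IsPath A u v ([u] ++ [v]) :=
    (isPath_singleton u).append (isPath_singleton v) huv
  have hfin := hp.append huvp htu
  have hune : u ≠ v := by rintro rfl; exact h.irr _ huv
  simp only [Finset.mem_insert, Finset.mem_union, List.mem_toFinset, not_or] at hu hv hCm
  have hpm : ∀ x, x ∈ p ↔ x ∈ S ∨ x ∈ C.flatten := by
    intro x
    rw [hpp.mem_iff, List.mem_append]
  have hpnd : p.Nodup := by
    rw [hpp.nodup_iff, List.nodup_append]
    refine ⟨hSnd, hCnd, ?_⟩
    rintro x hx y hy rfl
    exact ((hCm x).1 hy).2.2.2 hx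
  refine ⟨p ++ ([u] ++ [v]), ?_, ?_, hfin.1, ?_⟩
  · rw [List.nodup_append]
    refine ⟨hpnd, by simpa using hune, ?_⟩
    rintro x hx y hy rfl
    rw [hpm] at hx
    have hxuv : x = u ∨ x = v := by simpa using hy
    rcases hx with hx | hx
    · rcases hxuv with rfl | rfl
      · exact hu.2 hx
      · exact hv.2 hx
    · rw [hCm] at hx
      rcases hxuv with rfl | rfl
      · exact hx.1 rfl
      · exact hx.2.1 rfl
  · intro x
    have h1 : x ∈ p ++ ([u] ++ [v]) ↔ x ∈ p ∨ x = u ∨ x = v := by simp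
    rw [h1, hpm, hCm]
    constructor
    · rintro ((hx | hx) | rfl | rfl)
      · exact hSU x hx
      · exact hx.2.2.1
      · exact hu.1
      · exact hv.1
    · intro hx
      tauto
  · intro hne
    have h1 := hfin.2.1
    have h2 := hfin.2.2
    rw [List.head?_eq_some_head hne] at h1
    rw [List.getLast?_eq_some_getLast hne] at h2
    rw [Option.some.inj h1, Option.some.inj h2]
    exact hvs

theorem good_of_not_EC {V : Type*} [Fintype V] {A : V → V → Prop} {ε : ℝ}
    (hirr : ∀ v, ¬ A v v)
    (hdeg : ∀ v : V, (Fintype.card V : ℝ) / 2 ≤ (outDeg A v : ℝ) ∧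
      (Fintype.card V : ℝ) / 2 ≤ (inDeg A v : ℝ))
    (hEC : ¬ SatisfiesEC A ε) : Good A ε := by
  refine ⟨hirr, ?_, ?_, ?_⟩
  · intro v
    have h1 := (hdeg v).1
    rw [outDeg, ← Finset.coe_filter_univ, Set.ncard_coe_finset] at h1
    exact h1
  · intro v
    have h1 := (hdeg v).2
    rw [inDeg, ← Finset.coe_filter_univ, Set.ncard_coe_finset] at h1
    exact h1
  · intro X Y hX hY
    by_contra hcon
    refine hEC ⟨(X : Set V), (Y : Set V), ?_, ?_, ?_⟩
    · rwa [Set.ncard_coe_finset]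
    · rwa [Set.ncard_coe_finset]
    · rw [not_lt] at hcon
      refine le_trans (le_of_eq ?_) hcon
      rw [arcsCount, ← Set.ncard_coe_finset]
      congr 2
      ext p
      simp [and_assoc]

theorem exists_consts (r : ℝ) (hr0 : 0 < r) (hr1 : r < 1) (m : ℕ) (hm : 0 < m) :
    ∃ N : ℕ, ∀ n ≥ N, r ^ (n / m) * (n : ℝ) ^ 2 < 1 := by
  have h1 := tendsto_pow_const_mul_const_pow_of_abs_lt_one 2 (r := r)
    (by rw [abs_of_pos hr0]; exact hr1)
  have hm' : (0 : ℝ) < m := by exact_mod_cast hm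
  have h2 := h1.eventually (gt_mem_nhds (show (0 : ℝ) < r / (m : ℝ) ^ 2 by positivity))
  obtain ⟨N, hN⟩ := Filter.eventually_atTop.1 h2
  refine ⟨m * N, fun n hn => ?_⟩
  have h3 : N ≤ n / m := (Nat.le_div_iff_mul_le hm).2 (by rwa [mul_comm])
  have h4 := hN (n / m + 1) (by omega)
  have h5 : n < m * (n / m + 1) := Nat.lt_mul_div_succ n hm
  have h6 : (n : ℝ) ≤ m * ((n / m + 1 : ℕ) : ℝ) := by exact_mod_cast h5.le
  set T := n / m
  have h7 : (n : ℝ) ^ 2 ≤ (m * ((T + 1 : ℕ) : ℝ)) ^ 2 := by gcongr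
  rw [lt_div_iff₀ (by positivity), pow_succ] at h4
  have h8 : r ^ T * (m * ((T + 1 : ℕ) : ℝ)) ^ 2 < 1 := by
    have h9 : r * (r ^ T * (m * ((T + 1 : ℕ) : ℝ)) ^ 2) < r * 1 := by
      calc _ = ((T + 1 : ℕ) : ℝ) ^ 2 * (r ^ (T + 1)) * (m : ℝ) ^ 2 := by ring
        _ < r := by simpa [pow_succ] using h4
        _ = r * 1 := by ring
    exact lt_of_mul_lt_mul_left h9 hr0.le
  exact lt_of_le_of_lt (mul_le_mul_of_nonneg_left h7 (by positivity)) h8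


/-- **Path-Covering Lemma.**  For every `ε' ∈ (0,1)` there are `γ > 0` and `n₀` such that
for all `n ≥ n₀` and `k ≤ γn`: if `D` is a digraph on `n` vertices with
`δ⁰(D) ≥ n/2 + k` not satisfying **EC** with parameter `ε'`, and `U ⊆ V(D)` has size at
most `γn`, then `D - U` contains a Hamiltonian cycle; in particular `D - U` contains a
Hamiltonian directed path. -/
theorem path_covering_lemma (ε' : ℝ) (hε'0 : 0 < ε') (hε'1 : ε' < 1) :
    ∃ (γ : ℝ) (n₀ : ℕ), 0 < γ ∧
      ∀ n k : ℕ, n₀ ≤ n → (k : ℝ) ≤ γ * n →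
        ∀ (V : Type) [Fintype V] (A : V → V → Prop),
          (∀ v, ¬ A v v) →
          Fintype.card V = n →
          (∀ v : V, (n : ℝ) / 2 + k ≤ (outDeg A v : ℝ) ∧
                    (n : ℝ) / 2 + k ≤ (inDeg A v : ℝ)) →
          ¬ SatisfiesEC A ε' →
          ∀ U : Set V, (U.ncard : ℝ) ≤ γ * n →
            (∃ c : List V, c.Nodup ∧ (∀ v : V, v ∈ c ↔ v ∉ U) ∧ c.Chain' A ∧
              ∀ h : c ≠ [], A (c.getLast h) (c.head h)) ∧
            (∃ p : List V, p.Nodup ∧ (∀ v : V, v ∈ p ↔ v ∉ U) ∧ p.Chain' A) := by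
  have hε2 : 0 < ε' ^ 2 := by positivity
  have hε2' : ε' ^ 2 < 1 := by nlinarith
  obtain ⟨K, hK⟩ : ∃ K : ℕ, 8 / ε' ^ 2 ≤ K := ⟨_, Nat.le_ceil _⟩
  obtain ⟨m, hm⟩ : ∃ m : ℕ, 16 * K / ε' < m := exists_nat_gt _
  have hm0 : (0 : ℝ) < m := lt_of_le_of_lt (by positivity) hm
  obtain ⟨N, hN⟩ := exists_consts (1 - ε' ^ 2) (by linarith) (by linarith) m
    (by exact_mod_cast hm0)
  obtain ⟨N2, hN2⟩ : ∃ N2 : ℕ, 12 / ε' ≤ N2 := ⟨_, Nat.le_ceil _⟩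
  refine ⟨ε' / 2, N + N2 + K + 1, by linarith, ?_⟩
  intro n k hn hk V _ A hirr hcard hdeg hEC U hU
  have hnN : N ≤ n := by omega
  have hn2 : (N2 : ℝ) ≤ n := by exact_mod_cast (by omega : N2 ≤ n)
  have hnK : (K : ℝ) ≤ n := by exact_mod_cast (by omega : K ≤ n)
  have hn1 : (1 : ℝ) ≤ n := by exact_mod_cast (by omega : 1 ≤ n)
  have hk0 : (0 : ℝ) ≤ k := Nat.cast_nonneg k
  have hgood : Good A ε' := good_of_not_EC hirr (fun v => by
    rw [hcard]
    exact ⟨by linarith [(hdeg v).1], by linarith [(hdeg v).2]⟩) hEC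
  have hUf : U.toFinset.card = U.ncard := (Set.ncard_eq_toFinset_card' U).symm
  have hUc : (U.toFinset.card : ℝ) ≤ ε' / 2 * n := by rw [hUf]; exact hU
  obtain ⟨s, hs⟩ : ∃ s, s ∉ U.toFinset := by
    by_contra hcon
    push Not at hcon
    have h1 : U.toFinset = Finset.univ := Finset.eq_univ_iff_forall.2 hcon
    rw [h1, Finset.card_univ, hcard] at hUc
    nlinarith
  have hTm : ((n / m : ℕ) : ℝ) * m ≤ n := by exact_mod_cast Nat.div_mul_le_self n m
  have h16 : 16 * (K : ℝ) ≤ ε' * m := by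
    rw [div_lt_iff₀ hε'0] at hm
    linarith
  have hTK : 4 * (((n / m : ℕ) : ℝ) * K) ≤ ε' / 4 * n := by
    have hT0 : (0 : ℝ) ≤ ((n / m : ℕ) : ℝ) := Nat.cast_nonneg _
    have h1 := mul_le_mul_of_nonneg_left h16 hT0
    have h2 := mul_le_mul_of_nonneg_left hTm hε'0.le
    nlinarith
  have h12 : 12 ≤ ε' * n := by
    have h1 := hN2.trans hn2
    rw [div_le_iff₀ hε'0] at h1
    linarith
  have h8 : 8 ≤ ε' ^ 2 * n := by
    have h1 := hK.trans hnK
    rw [div_le_iff₀ hε2] at h1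
    linarith
  have h8K : 8 ≤ ε' ^ 2 * K := by
    rw [div_le_iff₀ hε2] at hK
    linarith
  have hLlow : ε' ^ 2 * n / 4 < (⌊ε' ^ 2 * n / 4⌋₊ : ℝ) + 1 := Nat.lt_floor_add_one _
  have hLup : (⌊ε' ^ 2 * n / 4⌋₊ : ℝ) ≤ ε' ^ 2 * n / 4 := Nat.floor_le (by positivity)
  obtain ⟨c, hc1, hc2, hc3, hc4⟩ := hgood.hamilton hε2'.le hs (n / m) K ⌊ε' ^ 2 * n / 4⌋₊
    (by rw [hcard]; exact hN n hnN)
    (by rw [hcard]; linarith)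
    (by
      rw [hcard]
      have h1 := mul_le_mul_of_nonneg_right hLup (show (0 : ℝ) ≤ n by linarith)
      nlinarith)
    (by
      rw [hcard]
      have hKpos : (0 : ℝ) ≤ K := Nat.cast_nonneg K
      have h1 : ε' ^ 2 * n / 8 < (⌊ε' ^ 2 * n / 4⌋₊ : ℝ) := by linarith
      have h2 : ((K : ℝ) + 1) * (ε' ^ 2 * n / 8) < (K + 1) * (⌊ε' ^ 2 * n / 4⌋₊ : ℝ) :=
        mul_lt_mul_of_pos_left h1 (by linarith)
      have h3 := mul_le_mul_of_nonneg_right h8K (show (0 : ℝ) ≤ n by linarith)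
      have h4 : (n : ℝ) < (K + 1) * (⌊ε' ^ 2 * n / 4⌋₊ : ℝ) := by nlinarith
      exact_mod_cast h4)
  have hc2' : ∀ v : V, v ∈ c ↔ v ∉ U := fun v => by rw [hc2 v, Set.mem_toFinset]
  exact ⟨⟨c, hc1, hc2', hc3, hc4⟩, ⟨c, hc1, hc2', hc3⟩⟩
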